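/- Suppose that a group G is hyperbolic relative to a collection of subgroups {H_λ}_{λ∈Λ}. Then the number of conjugacy classes of hyperbolic elements of finite order in G is finite; in particular, the set of orders of hyperbolic elements of G is finite. -/

import Mathlib

namespace RelHyp

variable {G : Type*} [Group G] {Λ : Type*}

/-- Length of a shortest word over the alphabet `S ∪ S⁻¹` representing `g`. -/
noncomputable def wordLength (S : Set G) (g : G) : ℕ :=
  sInf {n | ∃ w : List G, w.length = n ∧ (∀ x ∈ w, x ∈ S ∨ x⁻¹ ∈ S) ∧ w.prod = g}

/-- The free product `F = (∗_λ H_λ) ∗ F(X)`. -/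
abbrev RelFree (H : Λ → Subgroup G) (X : Set G) : Type _ :=
  Monoid.Coprod (Monoid.CoprodI fun l => ↥(H l)) (FreeGroup ↥X)

/-- The canonical homomorphism `ε : F → G`. -/
def relEps (H : Λ → Subgroup G) (X : Set G) : RelFree H X →* G :=
  Monoid.Coprod.lift (Monoid.CoprodI.lift fun l => (H l).subtype)
    (FreeGroup.lift fun x => (x : G))

/-- Letters of the alphabet `X ∪ 𝓗`, where `𝓗 = ⊔_λ (H̃_λ ∖ {1})`. -/
abbrev RelLetter (H : Λ → Subgroup G) (X : Set G) : Type _ :=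
  (Σ l : Λ, {h : ↥(H l) // h ≠ 1}) ⊕ (↥X × Bool)

/-- The image of a letter in the free product `F`. -/
def RelLetter.toF {H : Λ → Subgroup G} {X : Set G} : RelLetter H X → RelFree H X
  | Sum.inl ⟨_, h⟩ => Monoid.Coprod.inl (Monoid.CoprodI.of h.1)
  | Sum.inr (x, b) => Monoid.Coprod.inr (if b then FreeGroup.of x else (FreeGroup.of x)⁻¹)

/-- The element of `G` represented by a letter. -/
def RelLetter.val {H : Λ → Subgroup G} {X : Set G} : RelLetter H X → G
  | Sum.inl ⟨_, h⟩ => (h.1 : G)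
  | Sum.inr (x, b) => if b then (x : G) else (x : G)⁻¹

/-- The index `λ` such that the letter belongs to `H̃_λ`, if any. -/
def RelLetter.hIndex {H : Λ → Subgroup G} {X : Set G} : RelLetter H X → Option Λ
  | Sum.inl ⟨l, _⟩ => some l
  | Sum.inr _ => none

/-- The element of `F` represented by a word over `X ∪ 𝓗`. -/
def wordToF {H : Λ → Subgroup G} {X : Set G} (w : List (RelLetter H X)) : RelFree H X :=
  (w.map RelLetter.toF).prod

/-- `f` is a relative isoperimetric function of the relative presentation `⟨X, H | R⟩`. -/
def IsIsoperFn (H : Λ → Subgroup G) (X : Set G) (R : Set (RelFree H X)) (f : ℕ → ℕ) : Prop :=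
  ∀ w : List (RelLetter H X), relEps H X (wordToF w) = 1 →
    ∃ k ≤ f w.length, ∃ r c : Fin k → RelFree H X,
      (∀ i, r i ∈ R) ∧ wordToF w = (List.ofFn fun i => (c i)⁻¹ * r i * c i).prod

/-- `⟨X, H | R⟩` is a finite relative presentation of `G` w.r.t. the collection `H`. -/
structure IsFiniteRelPres (H : Λ → Subgroup G) (X : Set G) (R : Set (RelFree H X)) : Prop where
  finX : X.Finite
  finR : R.Finite
  surj : Function.Surjective (relEps H X)
  ker : (relEps H X).ker = Subgroup.normalClosure R

/-- `G` is finitely presented relative to the collection of subgroups `H`. -/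
def FinitelyPresentedRel (H : Λ → Subgroup G) : Prop :=
  ∃ (X : Set G) (R : Set (RelFree H X)), IsFiniteRelPres H X R

/-- The relative area of a word representing `1`. -/
noncomputable def relArea (H : Λ → Subgroup G) (X : Set G) (R : Set (RelFree H X))
    (w : List (RelLetter H X)) : ℕ :=
  sInf {k | ∃ r c : Fin k → RelFree H X,
    (∀ i, r i ∈ R) ∧ wordToF w = (List.ofFn fun i => (c i)⁻¹ * r i * c i).prod}

/-- The relative Dehn function of the presentation `⟨X, H | R⟩`. -/
noncomputable def relDehn (H : Λ → Subgroup G) (X : Set G) (R : Set (RelFree H X))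
    (n : ℕ) : ℕ :=
  sSup {a | ∃ w : List (RelLetter H X), w.length ≤ n ∧ relEps H X (wordToF w) = 1 ∧
    a = relArea H X R w}

/-- The relative Dehn function is well-defined (finite for each value of the argument),
i.e. there exists a finite-valued relative isoperimetric function. -/
def DehnWellDefined (H : Λ → Subgroup G) (X : Set G) (R : Set (RelFree H X)) : Prop :=
  ∃ f : ℕ → ℕ, IsIsoperFn H X R f

/-- `f ⪯ g`. -/
def AsympLE (f g : ℕ → ℕ) : Prop := ∃ C K L : ℕ, ∀ n, f n ≤ C * g (K * n) + L * n

/-- `f ∼ g`. -/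
def AsympEquiv (f g : ℕ → ℕ) : Prop := AsympLE f g ∧ AsympLE g f

/-- `G` is hyperbolic relative to `H`: it admits a finite relative presentation with a
linear relative isoperimetric function. -/
def IsRelHyperbolic (H : Λ → Subgroup G) : Prop :=
  ∃ (X : Set G) (R : Set (RelFree H X)), IsFiniteRelPres H X R ∧
    ∃ A B : ℕ, IsIsoperFn H X R fun n => A * n + B

/-- The subnegative closure of `f`. -/
noncomputable def subnegClosure (f : ℕ → ℕ) (n : ℕ) : ℕ :=
  sSup {s | ∃ L : List ℕ, (∀ a ∈ L, 0 < a) ∧ L.sum = n ∧ s = (L.map f).sum}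

/-- A combinatorial path in the Cayley graph `Γ(G, X ∪ 𝓗)`: a starting vertex
together with the word labelling the path. -/
structure RelPath (H : Λ → Subgroup G) (X : Set G) where
  start : G
  word : List (RelLetter H X)

namespace RelPath

variable {H : Λ → Subgroup G} {X : Set G}

/-- The length of the path. -/
def len (p : RelPath H X) : ℕ := p.word.length

/-- The `k`-th vertex of the path. -/
def vertex (p : RelPath H X) (k : ℕ) : G :=
  p.start * ((p.word.take k).map RelLetter.val).prod

/-- The terminal vertex of the path. -/
def finish (p : RelPath H X) : G := p.vertex p.word.length

end RelPath

/-- The combinatorial metric `dist_{X ∪ 𝓗}` on `G`. -/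
noncomputable def relDist (H : Λ → Subgroup G) (X : Set G) (g h : G) : ℕ :=
  wordLength (X ∪ ⋃ l, (H l : Set G)) (g⁻¹ * h)

/-- The relative length `|g|_{X ∪ 𝓗}`. -/
noncomputable def relLen (H : Λ → Subgroup G) (X : Set G) (g : G) : ℕ :=
  wordLength (X ∪ ⋃ l, (H l : Set G)) g

/-- The word metric `dist_X` on `G`. -/
noncomputable def xDist (X : Set G) (g h : G) : ℕ := wordLength X (g⁻¹ * h)

variable {H : Λ → Subgroup G} {X : Set G}

/-- `p` is a `(λ, c)`-quasi-geodesic in `Γ(G, X ∪ 𝓗)`. -/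
def IsQuasiGeodesic (lam c : ℝ) (p : RelPath H X) : Prop :=
  ∀ i j : ℕ, i ≤ j → j ≤ p.len →
    ((j - i : ℕ) : ℝ) ≤ lam * (relDist H X (p.vertex i) (p.vertex j) : ℝ) + c

/-- `p` is a geodesic in `Γ(G, X ∪ 𝓗)`. -/
def IsGeodesic (p : RelPath H X) : Prop :=
  ∀ i j : ℕ, i ≤ j → j ≤ p.len → j - i = relDist H X (p.vertex i) (p.vertex j)

/-- The `k`-th letter of `p` is a letter of `H̃_l`. -/
def LetterIsH (p : RelPath H X) (l : Λ) (k : ℕ) : Prop :=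
  ∃ a, p.word[k]? = some a ∧ a.hIndex = some l

/-- The subpath of `p` consisting of the letters with indices `a, …, b` is an
`H_l`-component of `p` (a maximal nonempty `H_l`-subword). -/
def IsComponent (p : RelPath H X) (l : Λ) (a b : ℕ) : Prop :=
  a ≤ b ∧ b < p.len ∧ (∀ k, a ≤ k → k ≤ b → LetterIsH p l k) ∧
    (a = 0 ∨ ¬ LetterIsH p l (a - 1)) ∧ (b + 1 = p.len ∨ ¬ LetterIsH p l (b + 1))

/-- The `H_l`-components of `p` starting at index `a` and of `q` starting at `a'`
are connected (their vertices lie in the same left coset of `H_l`). -/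
def ConnectedComp (p q : RelPath H X) (l : Λ) (a a' : ℕ) : Prop :=
  (p.vertex a)⁻¹ * q.vertex a' ∈ H l

/-- `p` is a path without backtracking: all of its components are isolated. -/
def NoBacktracking (p : RelPath H X) : Prop :=
  ∀ l a b a' b', IsComponent p l a b → IsComponent p l a' b' →
    ConnectedComp p p l a a' → a = a' ∧ b = b'

/-- The `k`-th vertex of `p` is a phase vertex (not an inner vertex of a component). -/
def IsPhase (p : RelPath H X) (k : ℕ) : Prop :=
  ¬ ∃ l a b, IsComponent p l a b ∧ a < k ∧ k ≤ b

/-- `p` and `q` are `k`-similar: their endpoints are `X`-distance at most `k` apart. -/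
def Similar (k : ℝ) (p q : RelPath H X) : Prop :=
  (xDist X p.start q.start : ℝ) ≤ k ∧ (xDist X p.finish q.finish : ℝ) ≤ k

/-- The Rips thin-triangles condition for `Γ(G, X ∪ 𝓗)` with constant `δ`. -/
def RipsThin (H : Λ → Subgroup G) (X : Set G) (δ : ℝ) : Prop :=
  ∀ p q r : RelPath H X, IsGeodesic p → IsGeodesic q → IsGeodesic r →
    p.finish = q.start → q.finish = r.start → r.finish = p.start →
    ∀ i ≤ p.len, ∃ j : ℕ,
      (j ≤ q.len ∧ (relDist H X (p.vertex i) (q.vertex j) : ℝ) ≤ δ) ∨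
      (j ≤ r.len ∧ (relDist H X (p.vertex i) (r.vertex j) : ℝ) ≤ δ)

/-- The Cayley graph `Γ(G, X ∪ 𝓗)` is a hyperbolic metric space. -/
def CayleyHyperbolic (H : Λ → Subgroup G) (X : Set G) : Prop :=
  ∃ δ : ℝ, 0 ≤ δ ∧ RipsThin H X δ

/-- `R` is a relatively quasi-convex subgroup of `G`. -/
def RelQuasiconvex (H : Λ → Subgroup G) (X : Set G) (R : Subgroup G) : Prop :=
  ∃ σ : ℝ, 0 < σ ∧ ∀ p : RelPath H X, IsGeodesic p → p.start ∈ R → p.finish ∈ R →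
    ∀ k ≤ p.len, ∃ w ∈ R, (xDist X (p.vertex k) w : ℝ) ≤ σ

/-- `R` is a strongly relatively quasi-convex subgroup of `G`. -/
def StronglyRelQuasiconvex (H : Λ → Subgroup G) (X : Set G) (R : Subgroup G) : Prop :=
  RelQuasiconvex H X R ∧ ∀ (g : G) (l : Λ), {x : G | x ∈ R ∧ g * x * g⁻¹ ∈ H l}.Finite

/-- `g` is a hyperbolic element: it is not conjugate to an element of any `H_λ`. -/
def IsHypElt (H : Λ → Subgroup G) (g : G) : Prop :=
  ∀ l : Λ, ∀ x ∈ H l, ¬ IsConj g x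

end RelHyp

open RelHyp

namespace RelHyp

section Words

variable {G : Type*} [Group G] {Λ : Type*} {H : Λ → Subgroup G} {X : Set G}

/-- The element of `G` represented by a word. -/
def wordVal (w : List (RelLetter H X)) : G := (w.map RelLetter.val).prod

@[simp] theorem wordVal_nil : wordVal ([] : List (RelLetter H X)) = 1 := rfl

@[simp] theorem wordVal_cons (a : RelLetter H X) (w : List (RelLetter H X)) :
    wordVal (a :: w) = a.val * wordVal w := by
  simp [wordVal]

@[simp] theorem wordVal_append (u v : List (RelLetter H X)) :
    wordVal (u ++ v) = wordVal u * wordVal v := by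
  simp [wordVal]

theorem relEps_toF (a : RelLetter H X) : relEps H X a.toF = a.val := by
  rcases a with ⟨l, h⟩ | ⟨x, b⟩
  · simp [relEps, RelLetter.toF, RelLetter.val]
  · cases b <;> simp [relEps, RelLetter.toF, RelLetter.val]

theorem relEps_wordToF (w : List (RelLetter H X)) : relEps H X (wordToF w) = wordVal w := by
  simp only [wordToF, wordVal, map_list_prod, List.map_map]
  congr 2
  funext a
  exact relEps_toF a

theorem wordToF_append (u v : List (RelLetter H X)) :
    wordToF (u ++ v) = wordToF u * wordToF v := by
  simp [wordToF]

theorem exists_wordToF_eq (f : RelFree H X) : ∃ w : List (RelLetter H X), wordToF w = f := by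
  have hmul : ∀ f₁ f₂ : RelFree H X, (∃ w : List (RelLetter H X), wordToF w = f₁) →
      (∃ w : List (RelLetter H X), wordToF w = f₂) →
      ∃ w : List (RelLetter H X), wordToF w = f₁ * f₂ := by
    rintro _ _ ⟨u, rfl⟩ ⟨v, rfl⟩
    exact ⟨u ++ v, wordToF_append u v⟩
  induction f using Monoid.Coprod.induction_on with
  | inl m =>
    induction m using Monoid.CoprodI.induction_on with
    | one => exact ⟨[], by simp [wordToF]⟩
    | of l h =>
      by_cases hh : h = 1
      · exact ⟨[], by simp [wordToF, hh]⟩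
      · exact ⟨[Sum.inl ⟨l, h, hh⟩], by simp [wordToF, RelLetter.toF]⟩
    | mul x y hx hy => rw [map_mul]; exact hmul _ _ hx hy
  | inr n =>
    induction n using FreeGroup.induction_on with
    | C1 => exact ⟨[], by simp [wordToF]⟩
    | of x => exact ⟨[Sum.inr (x, true)], by simp [wordToF, RelLetter.toF]⟩
    | inv_of x _ => exact ⟨[Sum.inr (x, false)], by simp [wordToF, RelLetter.toF]⟩
    | mul x y hx hy => rw [map_mul]; exact hmul _ _ hx hy
  | mul x y hx hy => exact hmul _ _ hx hy

theorem mul_wordVal_map_range (w : ℕ → RelLetter H X) (x : ℕ → G)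
    (hx : ∀ t, x (t + 1) = x t * (w t).val) (s N : ℕ) :
    x s * wordVal ((List.range N).map fun i => w (s + i)) = x (s + N) := by
  induction N with
  | zero => simp
  | succ N ih =>
    rw [List.range_succ, List.map_append, wordVal_append, ← mul_assoc, ih, ← add_assoc, hx]
    simp

end Words

section Cochains

variable {G : Type*} [Group G] {Λ : Type*} {H : Λ → Subgroup G} {X : Set G}

/-- An integral cochain on the edges `g — g x` and `g — g H_λ` of the coned-off Cayley graph. -/
structure Cochain (H : Λ → Subgroup G) (X : Set G) where
  onX : G → X → ℤ
  onH : Λ → G → ℤ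

namespace Cochain

/-- The integral of a cochain along the path labelled by a single letter. -/
def edge (ω : Cochain H X) (g : G) : RelLetter H X → ℤ
  | Sum.inl ⟨l, h⟩ => ω.onH l (g * h.1) - ω.onH l g
  | Sum.inr (x, b) => if b then ω.onX g x else -ω.onX (g * (x : G)⁻¹) x

/-- The integral of a cochain along the path labelled by a word. -/
def integral (ω : Cochain H X) : G → List (RelLetter H X) → ℤ
  | _, [] => 0
  | g, a :: w => ω.edge g a + integral ω (g * a.val) w

theorem integral_append (ω : Cochain H X) (g : G) (u v : List (RelLetter H X)) :
    ω.integral g (u ++ v) = ω.integral g u + ω.integral (g * wordVal u) v := by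
  induction u generalizing g with
  | nil => simp [integral]
  | cons a u ih => simp [integral, ih, add_assoc, mul_assoc]

/-- Parallel transport along an element of the free product `F`. -/
def transport (ω : Cochain H X) : RelFree H X →* (Equiv.Perm (G × ℤ))ᵐᵒᵖ :=
  Monoid.Coprod.lift
    (Monoid.CoprodI.lift fun l =>
      { toFun := fun h => MulOpposite.op
          { toFun := fun p => (p.1 * h, p.2 + (ω.onH l (p.1 * h) - ω.onH l p.1))
            invFun := fun p => (p.1 * (h : G)⁻¹, p.2 + (ω.onH l (p.1 * (h : G)⁻¹) - ω.onH l p.1))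
            left_inv := fun p => Prod.ext (by simp) (by simp; ring)
            right_inv := fun p => Prod.ext (by simp) (by simp; ring) }
        map_one' := by
          apply MulOpposite.unop_injective
          ext p <;> simp
        map_mul' := fun h k => by
          apply MulOpposite.unop_injective
          refine Equiv.ext fun p => Prod.ext ?_ ?_
          · simp [mul_assoc]
          · simp [mul_assoc]; ring })
    (FreeGroup.lift fun x => MulOpposite.op
      { toFun := fun p => (p.1 * (x : G), p.2 + ω.onX p.1 x)
        invFun := fun p => (p.1 * (x : G)⁻¹, p.2 - ω.onX (p.1 * (x : G)⁻¹) x)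
        left_inv := fun p => by ext <;> simp
        right_inv := fun p => by ext <;> simp })

theorem transport_toF (ω : Cochain H X) (a : RelLetter H X) (p : G × ℤ) :
    (ω.transport a.toF).unop p = (p.1 * a.val, p.2 + ω.edge p.1 a) := by
  rcases a with ⟨l, h⟩ | ⟨x, b⟩
  · simp [transport, RelLetter.toF, RelLetter.val, edge]
  · cases b
    · simp only [transport, RelLetter.toF, RelLetter.val, edge, map_inv, Monoid.Coprod.lift_apply_inr,
        FreeGroup.lift_apply_of, Bool.false_eq_true, if_false, MulOpposite.unop_inv,
        MulOpposite.unop_op]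
      rfl
    · simp [transport, RelLetter.toF, RelLetter.val, edge]

theorem transport_wordToF (ω : Cochain H X) (w : List (RelLetter H X)) (p : G × ℤ) :
    (ω.transport (wordToF w)).unop p = (p.1 * wordVal w, p.2 + ω.integral p.1 w) := by
  induction w generalizing p with
  | nil => simp [wordToF, integral]
  | cons a w ih =>
    have : wordToF (a :: w) = a.toF * wordToF w := by simp [wordToF]
    rw [this, map_mul, MulOpposite.unop_mul, Equiv.Perm.mul_apply, transport_toF, ih]
    simp [integral, mul_assoc, add_assoc]

/-- The integral of a cochain along an element of the free product `F`, starting at `g`. -/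
def integralF (ω : Cochain H X) (g : G) (f : RelFree H X) : ℤ :=
  ((ω.transport f).unop (g, 0)).2

theorem integralF_wordToF (ω : Cochain H X) (g : G) (w : List (RelLetter H X)) :
    ω.integralF g (wordToF w) = ω.integral g w := by
  simp [integralF, transport_wordToF]

theorem integralF_mul (ω : Cochain H X) (g : G) (f₁ f₂ : RelFree H X) :
    ω.integralF g (f₁ * f₂) = ω.integralF g f₁ + ω.integralF (g * relEps H X f₁) f₂ := by
  obtain ⟨u, rfl⟩ := exists_wordToF_eq f₁
  obtain ⟨v, rfl⟩ := exists_wordToF_eq f₂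
  rw [← wordToF_append]
  simp only [integralF_wordToF, relEps_wordToF, integral_append]

theorem integralF_one (ω : Cochain H X) (g : G) : ω.integralF g 1 = 0 := by
  simp [integralF]

theorem integralF_conj (ω : Cochain H X) (g : G) (r c : RelFree H X) (hr : relEps H X r = 1) :
    ω.integralF g (c⁻¹ * r * c) = ω.integralF (g * (relEps H X c)⁻¹) r := by
  have h := ω.integralF_mul g c⁻¹ c
  rw [inv_mul_cancel, integralF_one, map_inv] at h
  rw [integralF_mul, integralF_mul]
  simp only [map_mul, map_inv, hr, mul_one]
  linarith

theorem integralF_ofFn_prod (ω : Cochain H X) (g : G) (k : ℕ) (f : Fin k → RelFree H X)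
    (hf : ∀ i, relEps H X (f i) = 1) :
    ω.integralF g (List.ofFn f).prod = ∑ i, ω.integralF g (f i) := by
  induction k with
  | zero => simp [integralF_one]
  | succ k ih =>
    rw [List.ofFn_succ, List.prod_cons, integralF_mul, hf 0, mul_one, Fin.sum_univ_succ,
      ih _ fun i => hf i.succ]

theorem integral_eq_zero (ω : Cochain H X) (g : G) (w : List (RelLetter H X))
    (hw : ∀ u a v, w = u ++ a :: v → ω.edge (g * wordVal u) a = 0) : ω.integral g w = 0 := by
  induction w generalizing g with
  | nil => rfl
  | cons a w ih =>
    have h0 : ω.edge g a = 0 := by simpa using hw [] a w rfl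
    have h1 : ω.integral (g * a.val) w = 0 := ih _ fun u b v h => by
      simpa [mul_assoc] using hw (a :: u) b v (by simp [h])
    simp [integral, h0, h1]

theorem integral_map_range (ω : Cochain H X) (w : ℕ → RelLetter H X) (x : ℕ → G)
    (hx : ∀ t, x (t + 1) = x t * (w t).val) (s N : ℕ) :
    ω.integral (x s) ((List.range N).map fun i => w (s + i)) =
      ∑ i ∈ Finset.range N, ω.edge (x (s + i)) (w (s + i)) := by
  induction N with
  | zero => simp [integral]
  | succ N ih =>
    rw [List.range_succ, List.map_append, integral_append, ih, mul_wordVal_map_range w x hx,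
      Finset.sum_range_succ]
    simp [integral]

end Cochain

/-- Every closed word `w` is homologous, in the coned-off Cayley graph, to a sum of at most
`A * w.length + B` translates of elements of `L`. -/
def HasLinearFilling (L : Set (List (RelLetter H X))) (A B : ℕ) : Prop :=
  ∀ (g : G) (w : List (RelLetter H X)), wordVal w = 1 → ∃ k ≤ A * w.length + B,
    ∃ (r : Fin k → List (RelLetter H X)) (c : Fin k → G), (∀ i, r i ∈ L) ∧
      ∀ ω : Cochain H X, ω.integral g w = ∑ i, ω.integral (c i) (r i)

/-- Every closed word is homologous, in the coned-off Cayley graph, to a sum of linearly many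
translates of finitely many closed words. -/
theorem IsRelHyperbolic.exists_linear_filling {H : Λ → Subgroup G} (hH : IsRelHyperbolic H) :
    ∃ (X : Set G) (L : Set (List (RelLetter H X))) (A B : ℕ), X.Finite ∧ L.Finite ∧
      (∀ g : G, ∃ w : List (RelLetter H X), wordVal w = g) ∧ (∀ r ∈ L, wordVal r = 1) ∧
      HasLinearFilling L A B := by
  obtain ⟨X, R, hR, A, B, hAB⟩ := hH
  choose word hword using fun f : RelFree H X => exists_wordToF_eq f
  have heps : ∀ r ∈ R, relEps H X r = 1 := fun r hr => by
    rw [← MonoidHom.mem_ker, hR.ker]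
    exact Subgroup.subset_normalClosure hr
  refine ⟨X, word '' R, A, B, hR.finX, hR.finR.image _, fun g => ?_, ?_, fun g w hw => ?_⟩
  · obtain ⟨f, hf⟩ := hR.surj g
    exact ⟨word f, by rw [← relEps_wordToF, hword, hf]⟩
  · rintro _ ⟨r, hr, rfl⟩
    rw [← relEps_wordToF, hword, heps r hr]
  · obtain ⟨k, hk, r, c, hr, hrc⟩ := hAB w (by rw [relEps_wordToF, hw])
    refine ⟨k, hk, fun i => word (r i), fun i => g * (relEps H X (c i))⁻¹,
      fun i => ⟨r i, hr i, rfl⟩, fun ω => ?_⟩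
    rw [← ω.integralF_wordToF, hrc, ω.integralF_ofFn_prod]
    · refine Finset.sum_congr rfl fun i _ => ?_
      rw [ω.integralF_conj _ _ _ (heps _ (hr i)), ← ω.integralF_wordToF, hword]
    · intro i
      simp [heps _ (hr i)]

end Cochains

section Metric

variable {G : Type*} [Group G] {Λ : Type*} (H : Λ → Subgroup G) (X : Set G)

/-- The length of a shortest word over `X ∪ 𝓗` representing `g`. -/
noncomputable def letterLen (g : G) : ℕ :=
  sInf {n | ∃ w : List (RelLetter H X), w.length = n ∧ wordVal w = g}

/-- The left-invariant word metric of the relative Cayley graph. -/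
noncomputable def letterDist (g h : G) : ℕ := letterLen H X (g⁻¹ * h)

variable {H X}

theorem letterLen_wordVal_le (w : List (RelLetter H X)) :
    letterLen H X (wordVal w) ≤ w.length :=
  Nat.sInf_le ⟨w, rfl, rfl⟩

theorem RelLetter.exists_val_eq_inv (a : RelLetter H X) : ∃ b : RelLetter H X, b.val = a.val⁻¹ := by
  rcases a with ⟨l, h, hh⟩ | ⟨x, b⟩
  · exact ⟨Sum.inl ⟨l, h⁻¹, inv_ne_one.mpr hh⟩, by simp [RelLetter.val]⟩
  · refine ⟨Sum.inr (x, !b), ?_⟩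
    cases b <;> simp [RelLetter.val]

theorem exists_wordVal_eq_inv (w : List (RelLetter H X)) :
    ∃ v : List (RelLetter H X), v.length = w.length ∧ wordVal v = (wordVal w)⁻¹ := by
  induction w with
  | nil => exact ⟨[], by simp⟩
  | cons a w ih =>
    obtain ⟨v, hv, hvw⟩ := ih
    obtain ⟨b, hb⟩ := a.exists_val_eq_inv
    exact ⟨v ++ [b], by simp [hv], by simp [hvw, hb]⟩

theorem letterDist_mul_wordVal_le (g : G) (w : List (RelLetter H X)) :
    letterDist H X g (g * wordVal w) ≤ w.length := by
  simpa [letterDist] using letterLen_wordVal_le w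

theorem letterDist_mul_val_le (g : G) (a : RelLetter H X) :
    letterDist H X g (g * a.val) ≤ 1 := by
  simpa using letterDist_mul_wordVal_le g [a]

theorem letterDist_mul_mem_le (g : G) {l : Λ} {h : G} (hh : h ∈ H l) :
    letterDist H X g (g * h) ≤ 1 := by
  by_cases h1 : h = 1
  · simpa [h1] using (letterDist_mul_wordVal_le (H := H) (X := X) g []).trans zero_le_one
  · exact letterDist_mul_val_le g (Sum.inl ⟨l, ⟨h, hh⟩, fun e => h1 (by simpa using e)⟩)

theorem exists_word_length_eq (hgen : ∀ g : G, ∃ w : List (RelLetter H X), wordVal w = g)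
    (g : G) :
    ∃ w : List (RelLetter H X), w.length = letterLen H X g ∧ wordVal w = g := by
  obtain ⟨w, hw⟩ := hgen g
  exact Nat.sInf_mem (s := {n | ∃ w : List (RelLetter H X), w.length = n ∧ wordVal w = g})
    ⟨_, w, rfl, hw⟩

theorem letterDist_comm (hgen : ∀ g : G, ∃ w : List (RelLetter H X), wordVal w = g)
    (g h : G) : letterDist H X g h = letterDist H X h g := by
  have key : ∀ g h : G, letterDist H X g h ≤ letterDist H X h g := fun g h => by
    obtain ⟨w, hw, hwv⟩ := exists_word_length_eq hgen (h⁻¹ * g)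
    obtain ⟨v, hv, hvw⟩ := exists_wordVal_eq_inv w
    have : g⁻¹ * h = wordVal v := by rw [hvw, hwv]; group
    rw [letterDist, this, letterDist, ← hw, ← hv]
    exact letterLen_wordVal_le v
  exact le_antisymm (key g h) (key h g)

theorem letterDist_triangle (hgen : ∀ g : G, ∃ w : List (RelLetter H X), wordVal w = g)
    (g h k : G) :
    letterDist H X g k ≤ letterDist H X g h + letterDist H X h k := by
  obtain ⟨u, hu, huv⟩ := exists_word_length_eq hgen (g⁻¹ * h)
  obtain ⟨v, hv, hvv⟩ := exists_word_length_eq hgen (h⁻¹ * k)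
  have : g⁻¹ * k = wordVal (u ++ v) := by rw [wordVal_append, huv, hvv]; group
  rw [letterDist, this, letterDist, letterDist, ← hu, ← hv, ← List.length_append]
  exact letterLen_wordVal_le _

theorem letterDist_self (g : G) : letterDist H X g g = 0 := by
  simpa using letterDist_mul_wordVal_le (H := H) (X := X) g []

end Metric

section Bump

variable {G : Type*} [Group G] {Λ : Type*} (H : Λ → Subgroup G) (X : Set G)

/-- The truncated cone function of radius `τ` centred at `c`. -/
noncomputable def cone (c : G) (τ : ℕ) (g : G) : ℕ := τ - letterDist H X c g

/-- The maximum of `cone` over the coset `g H_l`. -/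
noncomputable def cosetCone (c : G) (τ : ℕ) (l : Λ) (g : G) : ℕ :=
  sSup {n | ∃ h ∈ H l, cone H X c τ (g * h) = n}

/-- The cochain `χ df`, where `χ` is the cone function of radius `τ` at `c` and `f` is the distance
from `b`. -/
noncomputable def bump (c b : G) (τ : ℕ) : Cochain H X where
  onX g x := cone H X c τ g * ((letterDist H X b (g * x) : ℤ) - letterDist H X b g)
  onH l g := cosetCone H X c τ l g * letterDist H X b g

variable {H X}

theorem cosetCone_mul_mem (c : G) (τ : ℕ) (l : Λ) (g : G) {h : G} (hh : h ∈ H l) :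
    cosetCone H X c τ l (g * h) = cosetCone H X c τ l g := by
  unfold cosetCone
  congr 1
  ext n
  constructor
  · rintro ⟨k, hk, rfl⟩
    exact ⟨h * k, mul_mem hh hk, by rw [mul_assoc]⟩
  · rintro ⟨k, hk, rfl⟩
    exact ⟨h⁻¹ * k, mul_mem (inv_mem hh) hk, by simp [mul_assoc]⟩

theorem exists_cosetCone_eq (c : G) (τ : ℕ) (l : Λ) (g : G) :
    ∃ h ∈ H l, cone H X c τ (g * h) = cosetCone H X c τ l g := by
  refine Nat.sSup_mem (s := {n | ∃ h ∈ H l, cone H X c τ (g * h) = n}) ⟨_, 1, one_mem _, rfl⟩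
    ⟨τ, ?_⟩
  rintro _ ⟨h, _, rfl⟩
  exact Nat.sub_le _ _

theorem bump_edge (c b : G) (τ : ℕ) (g : G) (a : RelLetter H X) :
    ∃ g' : G, letterDist H X g g' ≤ 1 ∧ (bump H X c b τ).edge g a =
      cone H X c τ g' * ((letterDist H X b (g * a.val) : ℤ) - letterDist H X b g) := by
  rcases a with ⟨l, h, hh⟩ | ⟨x, _ | _⟩
  · obtain ⟨k, hk, hkc⟩ := exists_cosetCone_eq (X := X) c τ l g
    refine ⟨g * k, letterDist_mul_mem_le g hk, ?_⟩
    simp only [Cochain.edge, bump, RelLetter.val, hkc, cosetCone_mul_mem c τ l g h.2]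
    ring
  · refine ⟨g * (x : G)⁻¹, ?_, ?_⟩
    · exact letterDist_mul_val_le g (Sum.inr (x, false))
    · simp only [Cochain.edge, bump, RelLetter.val, Bool.false_eq_true, if_false,
        inv_mul_cancel_right]
      ring
  · exact ⟨g, by simp [letterDist_self], by simp [Cochain.edge, bump, RelLetter.val]⟩

theorem abs_letterDist_mul_val_sub_le (hgen : ∀ g : G, ∃ w : List (RelLetter H X), wordVal w = g)
    (b g : G) (a : RelLetter H X) :
    |(letterDist H X b (g * a.val) : ℤ) - letterDist H X b g| ≤ 1 := by
  have h1 := letterDist_mul_val_le g a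
  have h2 := letterDist_triangle hgen b g (g * a.val)
  have h3 := letterDist_triangle hgen b (g * a.val) g
  rw [letterDist_comm hgen (g * a.val) g] at h3
  rw [abs_le]
  omega

theorem bump_edge_eq_zero (hgen : ∀ g : G, ∃ w : List (RelLetter H X), wordVal w = g)
    {c : G} (b : G) {τ : ℕ} {g : G} (a : RelLetter H X)
    (hg : τ < letterDist H X c g) : (bump H X c b τ).edge g a = 0 := by
  obtain ⟨g', hg', he⟩ := bump_edge c b τ g a
  have h1 := letterDist_triangle hgen c g' g
  rw [letterDist_comm hgen g' g] at h1
  have h2 : cone H X c τ g' = 0 := by unfold cone; omega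
  rw [he, h2]
  simp

theorem le_bump_edge (hgen : ∀ g : G, ∃ w : List (RelLetter H X), wordVal w = g)
    {c b : G} (τ : ℕ) {g : G} {a : RelLetter H X}
    (hg : letterDist H X b (g * a.val) = letterDist H X b g + 1) :
    0 ≤ (bump H X c b τ).edge g a ∧
      (τ : ℤ) - letterDist H X c g - 1 ≤ (bump H X c b τ).edge g a := by
  obtain ⟨g', hg', he⟩ := bump_edge c b τ g a
  have h1 := letterDist_triangle hgen c g g'
  have h2 : τ ≤ cone H X c τ g' + letterDist H X c g' := by unfold cone; omega
  rw [he, hg]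
  push_cast
  constructor
  · simp
  · linarith

theorem abs_bump_integral_sub_le (hgen : ∀ g : G, ∃ w : List (RelLetter H X), wordVal w = g)
    (c b : G) (τ : ℕ) (m j : ℕ) (g : G) (w : List (RelLetter H X))
    (hm : |(cone H X c τ g : ℤ) - m| ≤ j) :
    |(bump H X c b τ).integral g w -
      m * ((letterDist H X b (g * wordVal w) : ℤ) - letterDist H X b g)| ≤
        w.length * (j + w.length) := by
  induction w generalizing g j with
  | nil => simp [Cochain.integral]
  | cons a w ih =>
    have lip : ∀ x y : G, letterDist H X x y ≤ 1 →
        |(cone H X c τ y : ℤ) - cone H X c τ x| ≤ 1 := fun x y hxy => by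
      have h1 := letterDist_triangle hgen c x y
      have h2 := letterDist_triangle hgen c y x
      rw [letterDist_comm hgen y x] at h2
      rw [abs_le]
      unfold cone
      omega
    obtain ⟨g', hg', he⟩ := bump_edge c b τ g a
    have h1 := lip g g' hg'
    have h2 := lip g (g * a.val) (letterDist_mul_val_le g a)
    have h3 := ih (j + 1) (g * a.val) (by
      push_cast
      calc _ ≤ _ := abs_sub_le _ (cone H X c τ g : ℤ) _
        _ ≤ _ := by linarith)
    have h4 : |((cone H X c τ g' : ℤ) - m) *
        ((letterDist H X b (g * a.val) : ℤ) - letterDist H X b g)| ≤ (j + 1) * 1 := by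
      rw [abs_mul]
      refine mul_le_mul ?_ (abs_letterDist_mul_val_sub_le hgen b g a) (abs_nonneg _) (by positivity)
      calc _ ≤ _ := abs_sub_le _ (cone H X c τ g : ℤ) _
        _ ≤ _ := by linarith
    rw [Cochain.integral, he, wordVal_cons, ← mul_assoc, List.length_cons]
    push_cast at h3 ⊢
    rw [abs_le] at h3 h4 ⊢
    constructor <;> nlinarith

theorem abs_bump_integral_le (hgen : ∀ g : G, ∃ w : List (RelLetter H X), wordVal w = g)
    (c b : G) (τ : ℕ) (g : G) (w : List (RelLetter H X))
    (hw : wordVal w = 1) : |(bump H X c b τ).integral g w| ≤ (w.length : ℤ) * w.length := by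
  have h := abs_bump_integral_sub_le hgen c b τ (cone H X c τ g) 0 g w (by simp)
  simpa [hw] using h

theorem bump_integral_eq_zero_of_length (hgen : ∀ g : G, ∃ w : List (RelLetter H X), wordVal w = g)
    {c : G} (b : G) {τ : ℕ} {g : G} (w : List (RelLetter H X))
    {p q : ℕ} (hw : w.length ≤ p + q) (hg : τ + p < letterDist H X c g)
    (hg' : τ + q < letterDist H X c (g * wordVal w)) : (bump H X c b τ).integral g w = 0 := by
  refine Cochain.integral_eq_zero _ _ _ fun u a v huv => bump_edge_eq_zero hgen b a ?_
  have h1 := letterDist_mul_wordVal_le g u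
  have h2 := letterDist_mul_wordVal_le (g * wordVal u) (a :: v)
  rw [mul_assoc, ← wordVal_append, ← huv] at h2
  have h3 := letterDist_triangle hgen c (g * wordVal u) g
  have h4 := letterDist_triangle hgen c (g * wordVal u) (g * wordVal w)
  rw [letterDist_comm hgen (g * wordVal u) g] at h3
  have h5 : w.length = u.length + (a :: v).length := by rw [huv, List.length_append]
  omega

theorem bump_integral_eq_zero (hgen : ∀ g : G, ∃ w : List (RelLetter H X), wordVal w = g)
    {c : G} (b : G) {τ : ℕ} {g : G} (w : List (RelLetter H X))
    (hw : wordVal w = 1) (hg : τ + w.length < letterDist H X c g) :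
    (bump H X c b τ).integral g w = 0 :=
  bump_integral_eq_zero_of_length hgen b w (p := w.length) (q := w.length) (by omega) hg
    (by simpa [hw] using hg)

end Bump

section LocalGeodesics

variable {G : Type*} [Group G] {Λ : Type*} {H : Λ → Subgroup G} {X : Set G}

theorem card_le_of_forall_sub_le {S : Finset ℕ} {D : ℕ}
    (hS : ∀ i ∈ S, ∀ j ∈ S, i ≤ j → j ≤ i + D) : S.card ≤ D + 1 := by
  rcases S.eq_empty_or_nonempty with rfl | hne
  · simp
  · have hsub : S ⊆ Finset.Icc (S.min' hne) (S.min' hne + D) := fun j hj =>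
      Finset.mem_Icc.mpr ⟨S.min'_le j hj, hS _ (S.min'_mem hne) j hj (S.min'_le j hj)⟩
    calc S.card ≤ _ := Finset.card_le_card hsub
      _ = D + 1 := by rw [Nat.card_Icc]; omega

theorem exists_filling_radius (A B ρ : ℕ) :
    ∃ θ m₀ : ℕ, 2 * (2 * (2 * θ + 1) + 2 * ρ) + 2 ≤ m₀ ∧ ∀ D N : ℕ,
      D = 2 * (2 * θ + 1) + 2 * ρ → m₀ ≤ N →
        (A * (N + D) + B) * ((D + 1) * (ρ * ρ)) < (N - 2 * D - 2) * (θ * θ) := by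
  set E := (2 * A + 1) * (ρ * ρ) with hE
  set θ := 2 * E * (2 * ρ + 7) + 1 with hθ
  refine ⟨θ, 4 * (2 * (2 * θ + 1) + 2 * ρ) + 4 + B, by omega, fun D N hD hN => ?_⟩
  obtain ⟨M, hM⟩ : ∃ M, N = 2 * D + 2 + M := ⟨N - 2 * D - 2, by omega⟩
  have hNM : N - 2 * D - 2 = M := by omega
  rw [hNM]
  have h1 : A * (N + D) + B ≤ (2 * A + 1) * N := by
    have : A * (N + D) ≤ A * (2 * N) := Nat.mul_le_mul_left _ (by omega)
    nlinarith
  have h2 : 2 * E * (D + 1) < θ * θ := by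
    have h3 : θ * θ = 2 * E * ((2 * ρ + 7) * θ) + θ := by
      calc θ * θ = (2 * E * (2 * ρ + 7) + 1) * θ := by rw [← hθ]
        _ = _ := by ring
    have h4 : D + 1 ≤ (2 * ρ + 7) * θ := by
      have : 1 ≤ θ := by omega
      nlinarith
    have h5 := Nat.mul_le_mul_left (2 * E) h4
    omega
  have h3 : N ≤ 2 * M := by omega
  have hN0 : 0 < N := by omega
  have h4 : 2 * ((A * (N + D) + B) * ((D + 1) * (ρ * ρ))) < 2 * (M * (θ * θ)) := by
    calc 2 * ((A * (N + D) + B) * ((D + 1) * (ρ * ρ)))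
        ≤ 2 * (((2 * A + 1) * N) * ((D + 1) * (ρ * ρ))) := by gcongr
      _ = N * (2 * E * (D + 1)) := by rw [hE]; ring
      _ < N * (θ * θ) := Nat.mul_lt_mul_of_pos_left h2 hN0
      _ ≤ (2 * M) * (θ * θ) := Nat.mul_le_mul_right _ h3
      _ = _ := by ring
  omega

/-- A bump centred on a locally geodesic line integrates to at least `θ²` along an embedded part of
the line. -/
theorem sq_le_sum_bump_edge (hgen : ∀ g : G, ∃ w : List (RelLetter H X), wordVal w = g)
    {θ τ D m N s a : ℕ} {w : ℕ → RelLetter H X} {x : ℕ → G}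
    (hx : ∀ t, x (t + 1) = x t * (w t).val)
    (hgeo : ∀ i j, j ≤ m → letterDist H X (x i) (x (i + j)) = j)
    (hmin : ∀ i j, D < j → j < N → D < letterDist H X (x i) (x (i + j)))
    (hτ : τ = 2 * θ + 1) (hD : 2 * τ ≤ D) (hm : 2 * D + 2 ≤ m) (hsa : s + D < a)
    (haN : a + D < s + N) :
    (θ * θ : ℤ) ≤ ∑ i ∈ Finset.range N,
      (bump H X (x a) (x (a - (τ + 1))) τ).edge (x (s + i)) (w (s + i)) := by
  set b := a - (τ + 1) with hb
  have hstep : ∀ u, b ≤ u → u ≤ a + τ →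
      letterDist H X (x b) (x u * (w u).val) = letterDist H X (x b) (x u) + 1 := by
    intro u hu hu'
    rw [← hx]
    have h1 := hgeo b (u - b) (by omega)
    have h2 := hgeo b (u + 1 - b) (by omega)
    rw [show b + (u - b) = u by omega] at h1
    rw [show b + (u + 1 - b) = u + 1 by omega] at h2
    omega
  have hnonneg : ∀ i ∈ Finset.range N,
      0 ≤ (bump H X (x a) (x b) τ).edge (x (s + i)) (w (s + i)) := by
    intro i hi
    rw [Finset.mem_range] at hi
    by_cases hfar : τ < letterDist H X (x a) (x (s + i))
    · rw [bump_edge_eq_zero hgen _ _ hfar]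
    · refine (le_bump_edge hgen τ (hstep _ ?_ ?_)).1
      · by_contra hlt
        have h1 := hgeo (s + i) (a - (s + i))
        have h2 := hmin (s + i) (a - (s + i))
        rw [show s + i + (a - (s + i)) = a by omega, letterDist_comm hgen] at h1 h2
        omega
      · by_contra hlt
        have h1 := hgeo a (s + i - a)
        have h2 := hmin a (s + i - a)
        rw [show a + (s + i - a) = s + i by omega] at h1 h2
        omega
  have hsub : Finset.Ico (a - s) (a - s + θ) ⊆ Finset.range N := by
    intro i hi
    rw [Finset.mem_Ico] at hi
    rw [Finset.mem_range]
    omega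
  calc (θ * θ : ℤ) = ∑ i ∈ Finset.Ico (a - s) (a - s + θ), (θ : ℤ) := by simp
    _ ≤ ∑ i ∈ Finset.Ico (a - s) (a - s + θ),
        (bump H X (x a) (x b) τ).edge (x (s + i)) (w (s + i)) := by
      refine Finset.sum_le_sum fun i hi => ?_
      rw [Finset.mem_Ico] at hi
      have h1 := (le_bump_edge hgen (c := x a) τ (hstep (s + i) (by omega) (by omega))).2
      have h2 := hgeo a (s + i - a) (by omega)
      rw [show a + (s + i - a) = s + i by omega] at h2
      omega
    _ ≤ _ := Finset.sum_le_sum_of_subset_of_nonneg hsub fun i hi _ => hnonneg i hi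

/-- Locally geodesic lines with a sufficiently large local scale do not close up. -/
theorem HasLinearFilling.exists_localGeodesic_bound
    (hgen : ∀ g : G, ∃ w : List (RelLetter H X), wordVal w = g)
    {L : Set (List (RelLetter H X))} {A B : ℕ}
    (hL : HasLinearFilling L A B) (hfin : L.Finite) (hL1 : ∀ r ∈ L, wordVal r = 1) :
    ∃ m₀ : ℕ, ∀ (m P : ℕ) (w : ℕ → RelLetter H X) (x : ℕ → G),
      (∀ t, x (t + 1) = x t * (w t).val) →
      (∀ i j, j ≤ m → letterDist H X (x i) (x (i + j)) = j) → m ≤ P → x P = x 0 → m < m₀ := by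
  obtain ⟨ρ, hρ⟩ : ∃ ρ, ∀ r ∈ L, r.length ≤ ρ := by
    obtain ⟨ρ, hρ⟩ := (hfin.image List.length).bddAbove
    exact ⟨ρ, fun r hr => hρ ⟨r, hr, rfl⟩⟩
  obtain ⟨θ, m₀, hm₀, hmain⟩ := exists_filling_radius A B ρ
  refine ⟨m₀, fun m P w x hx hgeo hmP hP => ?_⟩
  by_contra! hm
  set τ := 2 * θ + 1 with hτ
  set D := 2 * τ + 2 * ρ with hD
  have hex : ∃ N, D < N ∧ ∃ s, letterDist H X (x s) (x (s + N)) ≤ D :=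
    ⟨P, by omega, 0, by simp [hP, letterDist_self]⟩
  classical
  obtain ⟨hDN, s, hsN⟩ := Nat.find_spec hex
  have hmin' : ∀ j, j < Nat.find hex → _ := fun j hj => Nat.find_min hex hj
  set N := Nat.find hex with hN
  have hmin : ∀ i j, D < j → j < N → D < letterDist H X (x i) (x (i + j)) := by
    intro i j hDj hjN
    by_contra! h
    exact hmin' j hjN ⟨hDj, i, h⟩
  have hmN : m < N := by
    by_contra! h
    have := hgeo s N h
    omega
  obtain ⟨σ, hσ, hσv⟩ := exists_word_length_eq hgen ((x (s + N))⁻¹ * x s)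
  change σ.length = letterDist H X (x (s + N)) (x s) at hσ
  rw [letterDist_comm hgen] at hσ
  set loop := ((List.range N).map fun i => w (s + i)) ++ σ with hloop
  have hpath : ∀ N, x s * wordVal ((List.range N).map fun i => w (s + i)) = x (s + N) :=
    mul_wordVal_map_range w x hx s
  have hclosed : wordVal loop = 1 := by
    have : x s * wordVal loop = x s := by
      rw [hloop, wordVal_append, ← mul_assoc, hpath, hσv, mul_inv_cancel_left]
    simpa using this
  obtain ⟨k, hk, r, c, hr, hrc⟩ := hL (x s) loop hclosed
  set n := N - 2 * D - 2 with hn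
  obtain ⟨a, ha⟩ : ∃ a : ℕ → ℕ, ∀ i, a i = s + D + 1 + i := ⟨_, fun _ => rfl⟩
  set ω : ℕ → Cochain H X := fun i => bump H X (x (a i)) (x (a i - (τ + 1))) τ with hω
  have hlower : ∀ i ∈ Finset.range n, (θ * θ : ℤ) ≤ (ω i).integral (x s) loop := by
    intro i hi
    rw [Finset.mem_range] at hi
    have hai := ha i
    have hσ0 : (ω i).integral (x (s + N)) σ = 0 := by
      refine bump_integral_eq_zero_of_length hgen _ σ (p := τ + ρ) (q := τ + ρ) (by omega) ?_ ?_
      · have h1 := hmin (a i) (s + N - a i) (by omega) (by omega)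
        rw [show a i + (s + N - a i) = s + N by omega] at h1
        omega
      · have h1 := hmin s (a i - s) (by omega) (by omega)
        rw [show s + (a i - s) = a i by omega, letterDist_comm hgen] at h1
        rw [hσv, mul_inv_cancel_left]
        omega
    rw [hloop, Cochain.integral_append, hpath, hσ0, add_zero, Cochain.integral_map_range _ w x hx]
    exact sq_le_sum_bump_edge hgen hx hgeo hmin hτ (by omega) (by omega) (by omega) (by omega)
  have hupper : ∀ κ, ∑ i ∈ Finset.range n, (ω i).integral (c κ) (r κ) ≤
      ((D + 1) * (ρ * ρ) : ℕ) := by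
    intro κ
    have hle : ∀ i, (ω i).integral (c κ) (r κ) ≤
        if letterDist H X (x (a i)) (c κ) ≤ τ + ρ then (ρ * ρ : ℤ) else 0 := by
      intro i
      have hlen := hρ _ (hr κ)
      split_ifs with hd
      · refine (le_abs_self _).trans
          ((abs_bump_integral_le hgen _ _ _ _ _ (hL1 _ (hr κ))).trans ?_)
        exact_mod_cast Nat.mul_le_mul hlen hlen
      · rw [bump_integral_eq_zero hgen _ _ (hL1 _ (hr κ)) (by omega)]
    refine (Finset.sum_le_sum fun i _ => hle i).trans ?_
    rw [← Finset.sum_filter, Finset.sum_const, nsmul_eq_mul]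
    have hcard : ((Finset.range n).filter fun i =>
        letterDist H X (x (a i)) (c κ) ≤ τ + ρ).card ≤ D + 1 := by
      refine card_le_of_forall_sub_le fun i hi j hj hij => ?_
      rw [Finset.mem_filter, Finset.mem_range] at hi hj
      have hai := ha i
      have haj := ha j
      by_contra! hlt
      have h1 := hmin (a i) (a j - a i) (by omega) (by omega)
      rw [show a i + (a j - a i) = a j by omega] at h1
      have h2 := letterDist_triangle hgen (x (a i)) (c κ) (x (a j))
      rw [letterDist_comm hgen (c κ)] at h2
      omega
    exact_mod_cast Nat.mul_le_mul_right (ρ * ρ) hcard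
  have hfinal : (n * (θ * θ) : ℤ) ≤ k * ((D + 1) * (ρ * ρ) : ℕ) := by
    calc (n * (θ * θ) : ℤ) = ∑ i ∈ Finset.range n, (θ * θ : ℤ) := by simp
      _ ≤ ∑ i ∈ Finset.range n, (ω i).integral (x s) loop := Finset.sum_le_sum hlower
      _ = ∑ κ, ∑ i ∈ Finset.range n, (ω i).integral (c κ) (r κ) := by
        rw [Finset.sum_comm]
        exact Finset.sum_congr rfl fun i _ => hrc _
      _ ≤ ∑ _κ : Fin k, (((D + 1) * (ρ * ρ) : ℕ) : ℤ) := Finset.sum_le_sum fun κ _ => hupper κ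
      _ = _ := by simp
  have hk' : k ≤ A * (N + D) + B := by
    have hlen : loop.length ≤ N + D := by
      rw [hloop, List.length_append, List.length_map, List.length_range]
      omega
    have := Nat.mul_le_mul_left A hlen
    omega
  have h1 := hmain D N rfl (by omega)
  rw [← hn] at h1
  have h2 := Nat.mul_le_mul_right ((D + 1) * (ρ * ρ)) hk'
  have h3 : n * (θ * θ) ≤ k * ((D + 1) * (ρ * ρ)) := by exact_mod_cast hfinal
  omega

end LocalGeodesics

section Angles

open scoped Pointwise

variable {G : Type*} [Group G] {Λ : Type*} {H : Λ → Subgroup G} {X : Set G}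

/-- The word length with respect to `S`, truncated at `K`. -/
noncomputable def cappedLen (S : Set G) (K : ℕ) (g : G) : ℕ := sInf {k | g ∈ S ^ k ∨ K ≤ k}

theorem cappedLen_spec (S : Set G) (K : ℕ) (g : G) :
    g ∈ S ^ cappedLen S K g ∨ K ≤ cappedLen S K g :=
  Nat.sInf_mem (s := {k | g ∈ S ^ k ∨ K ≤ k}) ⟨K, Or.inr le_rfl⟩

theorem cappedLen_one (S : Set G) (K : ℕ) : cappedLen S K 1 = 0 :=
  Nat.le_zero.mp (Nat.sInf_le (Or.inl (by simp)))

theorem cappedLen_mul_le (S : Set G) (K : ℕ) (g : G) {h : G} (hh : h ∈ S) :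
    cappedLen S K (g * h) ≤ cappedLen S K g + 1 := by
  refine Nat.sInf_le ?_
  rcases cappedLen_spec S K g with hg | hg
  · exact Or.inl (by rw [pow_succ]; exact Set.mul_mem_mul hg hh)
  · exact Or.inr (by omega)

theorem abs_cappedLen_mul_sub_le {S : Set G} (hS : ∀ h ∈ S, h⁻¹ ∈ S) (K : ℕ) (g : G) {h : G}
    (hh : h ∈ S) : |(cappedLen S K (g * h) : ℤ) - cappedLen S K g| ≤ 1 := by
  have h1 := cappedLen_mul_le S K g hh
  have h2 := cappedLen_mul_le S K (g * h) (hS h hh)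
  rw [mul_inv_cancel_right] at h2
  rw [abs_le]
  omega

open Classical in
/-- The cochain supported on the edges at the coset `c H_l`, with potential `p`. -/
noncomputable def angle (H : Λ → Subgroup G) (X : Set G) (l : Λ) (c : G) (p : G → ℕ) :
    Cochain H X where
  onX _ _ := 0
  onH l' g := if l' = l ∧ c⁻¹ * g ∈ H l then p (c⁻¹ * g) else 0

theorem RelLetter.val_mem_of_hIndex {a : RelLetter H X} {l : Λ} (ha : a.hIndex = some l) :
    a.val ∈ H l := by
  rcases a with ⟨l', h⟩ | ⟨x, b⟩
  · obtain rfl : l' = l := by simpa [RelLetter.hIndex] using ha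
    exact h.1.2
  · simp [RelLetter.hIndex] at ha

theorem angle_edge {l : Λ} {c : G} (p : G → ℕ) {g : G} {a : RelLetter H X}
    (ha : a.hIndex = some l) (hg : c⁻¹ * g ∈ H l) :
    (angle H X l c p).edge g a = (p (c⁻¹ * g * a.val) : ℤ) - p (c⁻¹ * g) := by
  have hga : c⁻¹ * (g * a.val) ∈ H l := by
    rw [← mul_assoc]
    exact mul_mem hg (RelLetter.val_mem_of_hIndex ha)
  rcases a with ⟨l', h⟩ | ⟨x, b⟩
  · obtain rfl : l' = l := by simpa [RelLetter.hIndex] using ha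
    simp only [RelLetter.val] at hga
    simp [Cochain.edge, angle, hg, hga, RelLetter.val, mul_assoc]
  · simp [RelLetter.hIndex] at ha

theorem angle_edge_eq_zero {l : Λ} {c : G} (p : G → ℕ) {g : G} {a : RelLetter H X}
    (h : ¬(a.hIndex = some l ∧ c⁻¹ * g ∈ H l)) : (angle H X l c p).edge g a = 0 := by
  rcases a with ⟨l', k, hk⟩ | ⟨x, b⟩
  · have h1 : ¬(l' = l ∧ c⁻¹ * g ∈ H l) := by simpa [RelLetter.hIndex] using h
    have h2 : ¬(l' = l ∧ c⁻¹ * (g * k) ∈ H l) := by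
      rintro ⟨rfl, h2⟩
      refine h1 ⟨rfl, ?_⟩
      rw [← mul_assoc] at h2
      exact (Subgroup.mul_mem_cancel_right _ k.2).mp h2
    simp [Cochain.edge, angle, h1, h2]
  · cases b <;> simp [Cochain.edge, angle]

theorem Cochain.sum_abs_integral_le {ι : Type*} (s : Finset ι) (ω : ι → Cochain H X)
    (r : List (RelLetter H X)) (hr : ∀ a ∈ r, ∀ g, ∑ j ∈ s, |(ω j).edge g a| ≤ 1) (g : G) :
    ∑ j ∈ s, |(ω j).integral g r| ≤ r.length := by
  induction r generalizing g with
  | nil => simp [Cochain.integral]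
  | cons a r ih =>
    have h1 := hr a (by simp) g
    have h2 := ih (fun b hb => hr b (by simp [hb])) (g * a.val)
    calc ∑ j ∈ s, |(ω j).integral g (a :: r)|
        ≤ ∑ j ∈ s, (|(ω j).edge g a| + |(ω j).integral (g * a.val) r|) :=
          Finset.sum_le_sum fun j _ => abs_add_le _ _
      _ ≤ _ := by
        rw [Finset.sum_add_distrib, List.length_cons]
        push_cast
        linarith

theorem sum_abs_angle_edge_le {ι : Type*} (s : Finset ι) {l : Λ} (c : ι → G) {p : G → ℕ}
    (hc : ∀ i ∈ s, ∀ j ∈ s, (c i)⁻¹ * c j ∈ H l → i = j) (g : G) (a : RelLetter H X)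
    (hp : ∀ y, |(p (y * a.val) : ℤ) - p y| ≤ 1) :
    ∑ j ∈ s, |(angle H X l (c j) p).edge g a| ≤ 1 := by
  by_cases hex : ∃ i ∈ s, a.hIndex = some l ∧ (c i)⁻¹ * g ∈ H l
  · obtain ⟨i, hi, ha, hg⟩ := hex
    rw [Finset.sum_eq_single_of_mem i hi, angle_edge p ha hg]
    · exact hp _
    · intro j hj hji
      rw [angle_edge_eq_zero, abs_zero]
      rintro ⟨-, hgj⟩
      refine hji (hc j hj i hi ?_)
      have := mul_mem hgj (inv_mem hg)
      rwa [mul_inv_rev, inv_inv, mul_assoc, mul_inv_cancel_left] at this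
  · push Not at hex
    rw [Finset.sum_eq_zero]
    · exact zero_le_one
    · intro j hj
      rw [angle_edge_eq_zero, abs_zero]
      rintro ⟨ha, hg⟩
      exact hex j hj ha hg

variable (H) in
/-- Two elements of `G` are near if they coincide or lie in a common coset of some `H_l`. -/
def Near (g h : G) : Prop := g = h ∨ ∃ l, g⁻¹ * h ∈ H l

theorem Near.letterDist_le {g h : G} (hgh : Near H g h) : letterDist H X g h ≤ 1 := by
  rcases hgh with rfl | ⟨l, hl⟩
  · rw [letterDist_self]
    exact zero_le_one
  · simpa using letterDist_mul_mem_le (X := X) g hl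

/-- The closing word of a nearly closed path. -/
theorem Near.exists_word {g h : G} (hgh : Near H g h) : ∃ σ : List (RelLetter H X),
    σ.length ≤ 1 ∧ h * wordVal σ = g ∧ ∀ a ∈ σ, ∃ l, a.hIndex = some l := by
  by_cases h1 : g = h
  · exact ⟨[], by simp [h1]⟩
  · obtain ⟨l, hl⟩ := hgh.resolve_left h1
    have hl' : h⁻¹ * g ∈ H l := by simpa using inv_mem hl
    have hne : (⟨h⁻¹ * g, hl'⟩ : H l) ≠ 1 := fun e => h1 <| by
      have : h⁻¹ * g = 1 := by simpa using e
      exact (inv_mul_eq_one.mp this).symm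
    exact ⟨[Sum.inl ⟨l, _, hne⟩], by simp, by simp [RelLetter.val],
      by simp [RelLetter.hIndex]⟩

/-- On a shortest nearly closed subpath of a line, every coset is visited along a single edge. -/
theorem eq_or_eq_succ_of_mem {N s u v : ℕ} {l : Λ} {w : ℕ → RelLetter H X} {x : ℕ → G}
    (hx : ∀ t, x (t + 1) = x t * (w t).val) (hN : 3 ≤ N)
    (hmin : ∀ i j, 2 ≤ j → j < N → ¬Near H (x i) (x (i + j)))
    (hsu : s ≤ u) (huN : u < s + N) (hsv : s ≤ v) (hvN : v ≤ s + N)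
    (hu : (w u).hIndex = some l) (hv : (x u)⁻¹ * x v ∈ H l) : v = u ∨ v = u + 1 := by
  have hmem := RelLetter.val_mem_of_hIndex hu
  have hv' : (x (u + 1))⁻¹ * x v ∈ H l := by
    rw [hx, mul_inv_rev, mul_assoc]
    exact mul_mem (inv_mem hmem) hv
  have key : ∀ i j, 2 ≤ j → j < N → (x i)⁻¹ * x (i + j) ∉ H l := fun i j h1 h2 h3 =>
    hmin i j h1 h2 (Or.inr ⟨l, h3⟩)
  have hinv : ∀ i j, (x i)⁻¹ * x j ∈ H l → (x j)⁻¹ * x i ∈ H l := fun i j h => by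
    simpa using inv_mem h
  by_contra! hne
  rcases lt_or_ge v u with hlt | hge
  · have h1 := key v (u + 1 - v) (by omega)
    have h2 := key v (u - v)
    rw [show v + (u + 1 - v) = u + 1 by omega] at h1
    rw [show v + (u - v) = u by omega] at h2
    have h3 : N ≤ u + 1 - v := by
      by_contra! h
      exact h1 h (hinv _ _ hv')
    exact h2 (by omega) (by omega) (hinv _ _ hv)
  · have h1 := key u (v - u) (by omega)
    have h2 := key (u + 1) (v - (u + 1))
    rw [show u + (v - u) = v by omega] at h1
    rw [show u + 1 + (v - (u + 1)) = v by omega] at h2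
    have h3 : N ≤ v - u := by
      by_contra! h
      exact h1 h hv
    exact h2 (by omega) (by omega) hv'

/-- The integral of an angle cochain along a shortest nearly closed subpath of a line. -/
theorem angle_integral_loop {N s u : ℕ} {l : Λ} {w : ℕ → RelLetter H X} {x : ℕ → G}
    (hx : ∀ t, x (t + 1) = x t * (w t).val) (hN : 3 ≤ N)
    (hmin : ∀ i j, 2 ≤ j → j < N → ¬Near H (x i) (x (i + j)))
    (hsu : s ≤ u) (huN : u < s + N) (hu : (w u).hIndex = some l) {σ : List (RelLetter H X)}
    (hσ : σ.length ≤ 1) (hσx : x (s + N) * wordVal σ = x s)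
    (hσl : ∀ a ∈ σ, ∃ l, a.hIndex = some l) {p : G → ℕ} (hp : p 1 = 0) :
    (angle H X l (x u) p).integral (x s) (((List.range N).map fun i => w (s + i)) ++ σ) =
      p (w u).val := by
  have huniq := fun v => eq_or_eq_succ_of_mem (v := v) (l := l) hx hN hmin hsu huN
  have hσ0 : (angle H X l (x u) p).integral (x (s + N)) σ = 0 := by
    rcases σ with _ | ⟨a, σ⟩
    · rfl
    · obtain rfl : σ = [] := by simpa using hσ
      simp only [Cochain.integral, add_zero]
      refine angle_edge_eq_zero p ?_
      rintro ⟨ha, hmem⟩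
      have h1 := huniq (s + N) (by omega) le_rfl hu hmem
      have h2 : (x u)⁻¹ * x s ∈ H l := by
        rw [← hσx, ← mul_assoc]
        exact mul_mem hmem (by simpa using RelLetter.val_mem_of_hIndex ha)
      have h3 := huniq s le_rfl (by omega) hu h2
      omega
  rw [Cochain.integral_append, mul_wordVal_map_range w x hx, hσ0, add_zero,
    Cochain.integral_map_range _ w x hx, Finset.sum_eq_single_of_mem (u - s)]
  · rw [show s + (u - s) = u by omega, angle_edge p hu (by simp [one_mem])]
    simp [hp]
  · rw [Finset.mem_range]
    omega
  · intro i hi hiu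
    rw [Finset.mem_range] at hi
    refine angle_edge_eq_zero p ?_
    rintro ⟨ha, hmem⟩
    have h1 := huniq (s + i) (by omega) (by omega) hu hmem
    have h2 : (x u)⁻¹ * x (s + i + 1) ∈ H l := by
      rw [hx, ← mul_assoc]
      exact mul_mem hmem (RelLetter.val_mem_of_hIndex ha)
    have h3 := huniq (s + i + 1) (by omega) (by omega) hu h2
    omega

theorem RelLetter.val_mem_of_hIndex_eq_none {a : RelLetter H X} (ha : a.hIndex = none) :
    a.val ∈ X ∪ X⁻¹ := by
  rcases a with ⟨l, h⟩ | ⟨y, _ | _⟩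
  · simp [RelLetter.hIndex] at ha
  · exact Or.inr (by simp [RelLetter.val])
  · exact Or.inl (by simp [RelLetter.val])

theorem finite_pow {S : Set G} (hS : S.Finite) (n : ℕ) : (S ^ n).Finite := by
  induction n with
  | zero => simp
  | succ n ih => rw [pow_succ]; exact ih.mul hS

/-- The letters along one period of a closed periodic line with local scale `m` belong to a finite
set depending only on `m`. -/
theorem HasLinearFilling.exists_finite_period {L : Set (List (RelLetter H X))} {A B : ℕ}
    (hL : HasLinearFilling L A B) (hX : X.Finite) (hfin : L.Finite) (m : ℕ) :
    ∃ E : Set G, E.Finite ∧ ∀ (P : ℕ) (w : ℕ → RelLetter H X) (x : ℕ → G), 2 ≤ m →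
      (∀ t, x (t + 1) = x t * (w t).val) →
      (∀ i j, j ≤ m → letterDist H X (x i) (x (i + j)) = j) → (∀ t, w (t + m) = w t) →
      m ≤ P → x P = x 0 → ∃ s, ∀ v, s ≤ v → v < s + m → (w v).val ∈ E := by
  obtain ⟨ρ, hρ⟩ : ∃ ρ, ∀ r ∈ L, r.length ≤ ρ := by
    obtain ⟨ρ, hρ⟩ := (hfin.image List.length).bddAbove
    exact ⟨ρ, fun r hr => hρ ⟨r, hr, rfl⟩⟩
  set S₀ : Set G := ⋃ r ∈ L, RelLetter.val '' {a | a ∈ r} with hS₀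
  have hS₀fin : S₀.Finite := hfin.biUnion fun r _ => (List.finite_toSet r).image _
  set S : Set G := insert 1 (S₀ ∪ S₀⁻¹) with hS
  have hSinv : ∀ h ∈ S, h⁻¹ ∈ S := by
    intro h hh
    simp only [hS, Set.mem_insert_iff, Set.mem_union, Set.mem_inv, inv_eq_one, inv_inv] at hh ⊢
    tauto
  have hSfin : S.Finite := (hS₀fin.union hS₀fin.inv).insert 1
  have hSmem : ∀ r ∈ L, ∀ a ∈ r, a.val ∈ S := fun r hr a ha =>
    Or.inr (Or.inl (Set.mem_biUnion hr ⟨a, ha, rfl⟩))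
  set K := (2 * A + B) * (2 * m) * ρ with hK
  refine ⟨S ^ K ∪ (X ∪ X⁻¹), (finite_pow hSfin K).union (hX.union hX.inv),
    fun P w x hm hx hgeo hper hmP hP => ?_⟩
  classical
  have hex : ∃ N, 2 ≤ N ∧ ∃ s, Near H (x s) (x (s + N)) :=
    ⟨P, by omega, 0, Or.inl (by simp [hP])⟩
  obtain ⟨h2N, s, hsN⟩ := Nat.find_spec hex
  have hmin' : ∀ j, j < Nat.find hex → _ := fun j hj => Nat.find_min hex hj
  set N := Nat.find hex with hN
  have hmin : ∀ i j, 2 ≤ j → j < N → ¬Near H (x i) (x (i + j)) := fun i j hj hjN h =>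
    hmin' j hjN ⟨hj, i, h⟩
  have hmN : m < N := by
    by_contra! h
    have h1 := hgeo s N h
    have h2 := hsN.letterDist_le (X := X)
    omega
  refine ⟨s, fun v hsv hvs => ?_⟩
  rcases hwv : (w v).hIndex with _ | l
  · exact Or.inr (RelLetter.val_mem_of_hIndex_eq_none hwv)
  left
  set n := N / m with hn
  have hnm : n * m ≤ N := Nat.div_mul_le_self N m
  have hn0 : 0 < n := Nat.div_pos hmN.le (by omega)
  have hNn : N ≤ 2 * m * n := by
    have h1 := Nat.lt_div_mul_add (a := N) (b := m) (by omega)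
    have h2 : 1 * m ≤ n * m := Nat.mul_le_mul_right m hn0
    rw [← hn] at h1
    nlinarith
  have hwj : ∀ j, w (v + j * m) = w v := fun j => by
    induction j with
    | zero => simp
    | succ j ih => rw [Nat.succ_mul, ← add_assoc, hper, ih]
  have hvj : ∀ j ∈ Finset.range n, v + j * m < s + N := fun j hj => by
    rw [Finset.mem_range] at hj
    have := Nat.mul_le_mul_right m (Nat.succ_le_of_lt hj)
    rw [Nat.succ_mul] at this
    omega
  obtain ⟨σ, hσ, hσx, hσl⟩ := hsN.exists_word (X := X)
  set loop := ((List.range N).map fun i => w (s + i)) ++ σ with hloop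
  have hclosed : wordVal loop = 1 := by
    have : x s * wordVal loop = x s := by
      rw [hloop, wordVal_append, ← mul_assoc, mul_wordVal_map_range w x hx, hσx]
    simpa using this
  obtain ⟨k, hk, r, c, hr, hrc⟩ := hL (x s) loop hclosed
  set p := cappedLen S (K + 1) with hp
  set ω : ℕ → Cochain H X := fun j => angle H X l (x (v + j * m)) p with hω
  have hvalue : ∀ j ∈ Finset.range n, (ω j).integral (x s) loop = p (w v).val := fun j hj => by
    rw [← hwj j]
    exact angle_integral_loop hx (by omega) hmin (by omega) (hvj j hj) (by rw [hwj, hwv]) hσ hσx hσl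
      (cappedLen_one S _)
  have hinj : ∀ i ∈ Finset.range n, ∀ j ∈ Finset.range n,
      (x (v + i * m))⁻¹ * x (v + j * m) ∈ H l → i = j := by
    intro i hi j hj hij
    have h1 := eq_or_eq_succ_of_mem hx (by omega) hmin (by omega) (hvj i hi)
      (by omega) (hvj j hj).le (by rw [hwj, hwv]) hij
    rcases lt_trichotomy i j with hlt | rfl | hlt
    · have := Nat.mul_le_mul_right m (Nat.succ_le_of_lt hlt)
      rw [Nat.succ_mul] at this
      omega
    · rfl
    · have := Nat.mul_le_mul_right m (Nat.succ_le_of_lt hlt)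
      rw [Nat.succ_mul] at this
      omega
  have hupper : ∀ κ, ∑ j ∈ Finset.range n, (ω j).integral (c κ) (r κ) ≤ ρ := fun κ =>
    calc ∑ j ∈ Finset.range n, (ω j).integral (c κ) (r κ)
        ≤ ∑ j ∈ Finset.range n, |(ω j).integral (c κ) (r κ)| :=
          Finset.sum_le_sum fun j _ => le_abs_self _
      _ ≤ (r κ).length := Cochain.sum_abs_integral_le _ _ _ (fun a ha g =>
          sum_abs_angle_edge_le _ _ hinj g a fun y =>
            abs_cappedLen_mul_sub_le hSinv _ y (hSmem _ (hr κ) a ha)) _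
      _ ≤ ρ := by exact_mod_cast hρ _ (hr κ)
  have hsum : (n * p (w v).val : ℤ) ≤ k * ρ := by
    calc (n * p (w v).val : ℤ) = ∑ j ∈ Finset.range n, (ω j).integral (x s) loop := by
          rw [Finset.sum_congr rfl hvalue]
          simp
      _ = ∑ κ, ∑ j ∈ Finset.range n, (ω j).integral (c κ) (r κ) := by
        rw [Finset.sum_comm]
        exact Finset.sum_congr rfl fun i _ => hrc _
      _ ≤ ∑ _κ : Fin k, (ρ : ℤ) := Finset.sum_le_sum fun κ _ => hupper κ
      _ = _ := by simp
  have hlen : loop.length ≤ N + 1 := by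
    rw [hloop, List.length_append, List.length_map, List.length_range]
    omega
  have hpK : p (w v).val ≤ K := by
    refine Nat.le_of_mul_le_mul_left ?_ hn0
    calc n * p (w v).val ≤ k * ρ := by exact_mod_cast hsum
      _ ≤ (A * (N + 1) + B) * ρ := by
        refine Nat.mul_le_mul_right ρ (hk.trans ?_)
        have := Nat.mul_le_mul_left A hlen
        omega
      _ ≤ ((2 * A + B) * N) * ρ := by
        refine Nat.mul_le_mul_right ρ ?_
        have : 1 ≤ N := by omega
        nlinarith
      _ ≤ ((2 * A + B) * (2 * m * n)) * ρ := by gcongr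
      _ = n * K := by rw [hK]; ring
  have hmem := (cappedLen_spec S (K + 1) (w v).val).resolve_right (by rw [← hp]; omega)
  exact Set.pow_subset_pow_right (Set.mem_insert 1 _) hpK hmem

end Angles

section TorsionClasses

open scoped Pointwise

variable {G : Type*} [Group G] {Λ : Type*} {H : Λ → Subgroup G} {X : Set G}

theorem wordVal_mem_pow {E : Set G} (w : List (RelLetter H X)) (hw : ∀ a ∈ w, a.val ∈ E) :
    wordVal w ∈ E ^ w.length := by
  induction w with
  | nil => simp
  | cons a w ih =>
    rw [wordVal_cons, List.length_cons, pow_succ']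
    exact Set.mul_mem_mul (hw a (by simp)) (ih fun b hb => hw b (by simp [hb]))

theorem orderOf_eq_of_isConj {g h : G} (hgh : IsConj g h) : orderOf g = orderOf h := by
  obtain ⟨c, rfl⟩ := isConj_iff.mp hgh
  exact ((MulAut.conj c).orderOf_eq g).symm

/-- A torsion element which is shortest in its conjugacy class labels a closed periodic line all of
whose subpaths of length at most one period are geodesic. -/
theorem exists_closed_line (hgen : ∀ g : G, ∃ w : List (RelLetter H X), wordVal w = g) {g : G}
    (hg : IsOfFinOrder g) (hg1 : g ≠ 1)
    (hmin : ∀ v : G, letterLen H X g ≤ letterLen H X (v⁻¹ * g * v)) :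
    ∃ (P : ℕ) (w : ℕ → RelLetter H X) (x : ℕ → G), (∀ t, x (t + 1) = x t * (w t).val) ∧
      (∀ i j, j ≤ letterLen H X g → letterDist H X (x i) (x (i + j)) = j) ∧
      (∀ t, w (t + letterLen H X g) = w t) ∧ letterLen H X g ≤ P ∧ x P = x 0 ∧
      ∀ t, x (t + letterLen H X g) = g * x t := by
  obtain ⟨W, hWl, hWg⟩ := exists_word_length_eq hgen g
  set m := letterLen H X g with hm
  have hm0 : 0 < m := by
    rw [Nat.pos_iff_ne_zero]
    intro h
    obtain rfl : W = [] := List.length_eq_zero_iff.mp (hWl.trans h)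
    exact hg1 (by simpa using hWg.symm)
  have hlt : ∀ t, t % m < W.length := fun t => (Nat.mod_lt t hm0).trans_eq hWl.symm
  let w : ℕ → RelLetter H X := fun t => W[t % m]'(hlt t)
  let x : ℕ → G := fun t => wordVal ((List.range t).map w)
  have hx : ∀ t, x (t + 1) = x t * (w t).val := fun t => by simp [x, List.range_succ]
  have hx0 : x 0 = 1 := by simp [x]
  have hper : ∀ t, w (t + m) = w t := fun t => by simp [w]
  have hxm : x m = g := by
    have : (List.range m).map w = W := by
      refine List.ext_getElem (by simp [hWl]) fun i h1 h2 => ?_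
      simp [w, Nat.mod_eq_of_lt (hWl ▸ h2)]
    simp only [x, this, hWg]
  have hshift : ∀ t, x (t + m) = g * x t := fun t => by
    induction t with
    | zero => simp [hx0, hxm]
    | succ t ih => rw [Nat.add_right_comm, hx, hx, ih, hper, mul_assoc]
  have hpow : ∀ n, x (n * m) = g ^ n := fun n => by
    induction n with
    | zero => simp [hx0]
    | succ n ih => rw [Nat.succ_mul, hshift, ih, pow_succ']
  have hle : ∀ i j, letterDist H X (x i) (x (i + j)) ≤ j := fun i j => by
    rw [← mul_wordVal_map_range w x hx]
    exact (letterDist_mul_wordVal_le _ _).trans (by simp)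
  refine ⟨orderOf g * m, w, x, hx, fun i j hj => (hle i j).antisymm ?_, hper,
    Nat.le_mul_of_pos_left m hg.orderOf_pos, by rw [hpow, pow_orderOf_eq_one, hx0], hshift⟩
  have h1 : m ≤ letterDist H X (x i) (x (i + m)) := by
    rw [hshift, letterDist, ← mul_assoc]
    exact hmin (x i)
  have h2 := letterDist_triangle hgen (x i) (x (i + j)) (x (i + m))
  have h3 := hle (i + j) (m - j)
  rw [show i + j + (m - j) = i + m by omega] at h3
  omega

/-- In a relatively hyperbolic group, the hyperbolic elements of finite order lie in finitely many
conjugacy classes. -/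
theorem IsRelHyperbolic.exists_finite_conj (hH : IsRelHyperbolic H) :
    ∃ E : Set G, E.Finite ∧ ∀ g, IsHypElt H g → IsOfFinOrder g → ∃ h ∈ E, IsConj g h := by
  obtain ⟨X, L, A, B, hX, hfin, hgen, hL1, hL⟩ := hH.exists_linear_filling
  obtain ⟨m₀, hm₀⟩ := hL.exists_localGeodesic_bound hgen hfin hL1
  choose E hE hEper using hL.exists_finite_period hX hfin
  refine ⟨{1} ∪ (X ∪ X⁻¹) ∪ ⋃ m ∈ Set.Iio m₀, E m ^ m,
    ((Set.finite_singleton 1).union (hX.union hX.inv)).union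
      ((Set.finite_Iio m₀).biUnion fun m _ => finite_pow (hE m) m), fun g₀ hhyp hg₀ => ?_⟩
  obtain ⟨u, hu⟩ : ∃ u : G, ∀ v : G,
      letterLen H X (u⁻¹ * g₀ * u) ≤ letterLen H X (v⁻¹ * g₀ * v) :=
    ⟨_, fun v => Function.argmin_le (fun u : G => letterLen H X (u⁻¹ * g₀ * u)) v⟩
  obtain ⟨g, hg⟩ : ∃ g, g = u⁻¹ * g₀ * u := ⟨_, rfl⟩
  have hconj : IsConj g₀ g := isConj_iff.mpr ⟨u⁻¹, by simp [hg]⟩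
  have hmin : ∀ v : G, letterLen H X g ≤ letterLen H X (v⁻¹ * g * v) := fun v => by
    have := hu (u * v)
    simpa [hg, mul_assoc] using this
  have hfing : IsOfFinOrder g := by
    rw [← orderOf_pos_iff, ← orderOf_eq_of_isConj hconj]
    exact hg₀.orderOf_pos
  by_cases hg1 : g = 1
  · exact ⟨g, Or.inl (Or.inl hg1), hconj⟩
  rcases Nat.lt_or_ge (letterLen H X g) 2 with hm | hm
  · obtain ⟨W, hWl, hWg⟩ := exists_word_length_eq hgen g
    obtain _ | ⟨a, _ | ⟨b, W⟩⟩ := W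
    · exact absurd (by simpa using hWg.symm) hg1
    · obtain rfl : a.val = g := by simpa using hWg
      refine ⟨a.val, Or.inl (Or.inr (RelLetter.val_mem_of_hIndex_eq_none ?_)), hconj⟩
      rcases ha : a.hIndex with _ | l
      · rfl
      · exact absurd hconj (hhyp l _ (RelLetter.val_mem_of_hIndex ha))
    · simp only [List.length_cons] at hWl
      omega
  · obtain ⟨P, w, x, hx, hgeo, hper, hmP, hP, hshift⟩ := exists_closed_line hgen hfing hg1 hmin
    obtain ⟨s, hs⟩ := hEper _ P w x hm hx hgeo hper hmP hP
    set m := letterLen H X g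
    have hval : wordVal ((List.range m).map fun i => w (s + i)) = (x s)⁻¹ * g * x s := by
      rw [mul_assoc, ← hshift, ← mul_wordVal_map_range w x hx, inv_mul_cancel_left]
    refine ⟨(x s)⁻¹ * g * x s, Or.inr (Set.mem_biUnion (hm₀ m P w x hx hgeo hmP hP) ?_),
      hconj.trans (isConj_iff.mpr ⟨(x s)⁻¹, by simp⟩)⟩
    have hmem := wordVal_mem_pow (E := E m) ((List.range m).map fun i => w (s + i)) fun a ha => by
      obtain ⟨i, hi, rfl⟩ := List.mem_map.mp ha
      rw [List.mem_range] at hi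
      exact hs _ (by omega) (by omega)
    rwa [hval, List.length_map, List.length_range] at hmem

end TorsionClasses

end RelHyp

/-- Theorem 1.14 / Theorem 4.2. If `G` is hyperbolic relative to a collection
of subgroups `{H_λ}_{λ∈Λ}`, then there are only finitely many conjugacy classes of hyperbolic
elements of finite order in `G`; in particular, the set of orders of hyperbolic elements is
finite. -/
theorem statement_13 {G : Type*} [Group G] {Λ : Type*} (H : Λ → Subgroup G)
    (hhyp : IsRelHyperbolic H) :
    {c : ConjClasses G | ∃ g : G, IsHypElt H g ∧ IsOfFinOrder g ∧ ConjClasses.mk g = c}.Finite ∧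
    {n : ℕ | ∃ g : G, IsHypElt H g ∧ IsOfFinOrder g ∧ orderOf g = n}.Finite := by
  obtain ⟨E, hE, hconj⟩ := hhyp.exists_finite_conj
  constructor
  · refine (hE.image ConjClasses.mk).subset ?_
    rintro _ ⟨g, hg, hfin, rfl⟩
    obtain ⟨h, hh, hgh⟩ := hconj g hg hfin
    exact ⟨h, hh, ConjClasses.mk_eq_mk_iff_isConj.mpr hgh.symm⟩
  · refine (hE.image orderOf).subset ?_
    rintro _ ⟨g, hg, hfin, rfl⟩
    obtain ⟨h, hh, hgh⟩ := hconj g hg hfin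
    exact ⟨h, hh, (orderOf_eq_of_isConj hgh).symm⟩
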